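/- arXiv:1603.05075 — 2 statements merged into one kernel-verified Lean document; each statement's English description precedes it below -/
import Mathlib

section
/- For any finite simple graph G on n vertices with adjacency matrix A, the independence number satisfies α(G) = max{ eᵀx : x ∈ SOL(G) } and moreover this maximum is attained at an integer vector, i.e. α(G) = max{ eᵀx : x ∈ SOL(G) ∩ ℤ^n }. -/
open Matrix Finset

/-- `x` solves the linear complementarity problem `LCP(A + I, -e)`, where `A` is the
adjacency matrix of the simple graph `G`, `I` is the identity matrix and `e` is the
all-ones vector: `x ≥ 0`, `(A+I)x ≥ e`, and `xᵀ((A+I)x − e) = 0`. -/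
def SolLCP {V : Type*} [Fintype V] [DecidableEq V] (G : SimpleGraph V) [DecidableRel G.Adj]
    (x : V → ℝ) : Prop :=
  (∀ i, 0 ≤ x i) ∧
  (∀ i, 1 ≤ ((G.adjMatrix ℝ + 1) *ᵥ x) i) ∧
  ∑ i, x i * (((G.adjMatrix ℝ + 1) *ᵥ x) i - 1) = 0

/-- `S` is an independent set of the simple graph `G`: its vertices are pairwise nonadjacent. -/
def IsIndepFinset {V : Type*} (G : SimpleGraph V) (S : Finset V) : Prop :=
  ∀ i ∈ S, ∀ j ∈ S, ¬ G.Adj i j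

/-- `S` is a maximal independent set of `G`: it is independent and is not properly
contained in any larger independent set. -/
def IsMaxIndepFinset {V : Type*} (G : SimpleGraph V) (S : Finset V) : Prop :=
  IsIndepFinset G S ∧ ∀ T : Finset V, IsIndepFinset G T → S ⊆ T → S = T

theorem IsIndepFinset.insert {V : Type*} [DecidableEq V] {G : SimpleGraph V} {S : Finset V}
    {i : V} (hS : IsIndepFinset G S) (hi : ∀ j ∈ S, ¬ G.Adj i j) :
    IsIndepFinset G (insert i S) := by
  simp only [IsIndepFinset, forall_mem_insert]
  exact ⟨⟨G.irrefl, hi⟩, fun a ha => ⟨fun h => hi a ha h.symm, hS a ha⟩⟩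

theorem adjMatrix_add_one_mulVec_apply {V : Type*} [Fintype V] [DecidableEq V]
    (G : SimpleGraph V) [DecidableRel G.Adj] (x : V → ℝ) (i : V) :
    ((G.adjMatrix ℝ + 1) *ᵥ x) i = ∑ j ∈ G.neighborFinset i, x j + x i := by
  rw [add_mulVec, one_mulVec, Pi.add_apply, SimpleGraph.adjMatrix_mulVec_apply]

/-- If the weights of every closed neighbourhood within `T` sum to at most one, then the greedy
algorithm finds an independent subset of `T` at least as large as the total weight. -/
theorem exists_isIndepFinset_sum_le_card {V : Type*} [DecidableEq V] (G : SimpleGraph V)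
    [DecidableRel G.Adj] (x : V → ℝ) (hx : ∀ i, 0 ≤ x i) (T : Finset V)
    (hT : ∀ i ∈ T, x i + ∑ j ∈ T with G.Adj i j, x j ≤ 1) :
    ∃ S ⊆ T, IsIndepFinset G S ∧ ∑ i ∈ T, x i ≤ S.card := by
  induction T using Finset.strongInduction with
  | H T ih =>
    obtain rfl | ⟨i, hi⟩ := T.eq_empty_or_nonempty
    · exact ⟨∅, subset_rfl, by simp [IsIndepFinset], by simp⟩
    set R : Finset V := {j ∈ T.erase i | ¬ G.Adj i j} with hR
    have hRT : R ⊆ T := (filter_subset _ _).trans (erase_subset _ _)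
    have hiR : i ∉ R := by simp [hR]
    obtain ⟨S, hSR, hS, hcard⟩ := ih R (hRT.ssubset_of_mem_notMem hi hiR) fun j hj => by
      have hle : ∑ k ∈ R with G.Adj j k, x k ≤ ∑ k ∈ T with G.Adj j k, x k :=
        sum_le_sum_of_subset_of_nonneg (filter_subset_filter _ hRT) fun k _ _ => hx k
      linarith [hT j (hRT hj)]
    have hadj : ∀ j ∈ S, ¬ G.Adj i j := fun j hj => (mem_filter.1 (hSR hj)).2
    refine ⟨insert i S, insert_subset hi (hSR.trans hRT), hS.insert hadj, ?_⟩
    have hnbr : ({j ∈ T.erase i | G.Adj i j} : Finset V) = {j ∈ T | G.Adj i j} := by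
      ext j
      simp only [mem_filter, mem_erase]
      exact ⟨fun h => ⟨h.1.2, h.2⟩, fun h => ⟨⟨h.2.ne', h.1⟩, h.2⟩⟩
    have hsum := sum_filter_add_sum_filter_not (T.erase i) (G.Adj i) x
    rw [hnbr, ← hR] at hsum
    have hins := add_sum_erase T x hi
    rw [card_insert_of_notMem fun h => hiR (hSR h)]
    push_cast
    linarith [hT i hi]

/-- On the support of a solution, complementarity makes the slack vanish. -/
theorem SolLCP.mulVec_eq_one {V : Type*} [Fintype V] [DecidableEq V] {G : SimpleGraph V}
    [DecidableRel G.Adj] {x : V → ℝ} (hx : SolLCP G x) {i : V} (hi : x i ≠ 0) :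
    ((G.adjMatrix ℝ + 1) *ᵥ x) i = 1 := by
  obtain ⟨h0, h1, hc⟩ := hx
  have hz := (sum_eq_zero_iff_of_nonneg
    fun j _ => mul_nonneg (h0 j) (sub_nonneg.2 (h1 j))).1 hc i (mem_univ i)
  exact sub_eq_zero.1 ((mul_eq_zero.1 hz).resolve_left hi)

theorem SolLCP.exists_isIndepFinset_sum_le_card {V : Type*} [Fintype V] [DecidableEq V]
    {G : SimpleGraph V} [DecidableRel G.Adj] {x : V → ℝ} (hx : SolLCP G x) :
    ∃ S : Finset V, IsIndepFinset G S ∧ ∑ i, x i ≤ S.card := by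
  obtain ⟨S, -, hS, hcard⟩ := _root_.exists_isIndepFinset_sum_le_card G x hx.1 {i | x i ≠ 0}
    fun i hi => by
      have h := hx.mulVec_eq_one (mem_filter.1 hi).2
      rw [adjMatrix_add_one_mulVec_apply] at h
      have hle : ∑ j ∈ ({i | x i ≠ 0} : Finset V) with G.Adj i j, x j
          ≤ ∑ j ∈ G.neighborFinset i, x j :=
        sum_le_sum_of_subset_of_nonneg
          (fun j hj => (G.mem_neighborFinset i j).2 (mem_filter.1 hj).2) fun j _ _ => hx.1 j
      linarith
  exact ⟨S, hS, by rwa [sum_filter_ne_zero] at hcard⟩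

/-- The indicator vector of a maximal independent set solves the complementarity problem. -/
theorem IsMaxIndepFinset.solLCP {V : Type*} [Fintype V] [DecidableEq V] {G : SimpleGraph V}
    [DecidableRel G.Adj] {S : Finset V} (hS : IsMaxIndepFinset G S) :
    SolLCP G fun i => if i ∈ S then 1 else 0 := by
  obtain ⟨hind, hmax⟩ := hS
  have hnonneg : ∀ i, (0 : ℝ) ≤ if i ∈ S then 1 else 0 := fun i => by split_ifs <;> norm_num
  have hone : ∀ i ∈ S,
      ((G.adjMatrix ℝ + 1) *ᵥ fun i => if i ∈ S then (1 : ℝ) else 0) i = 1 := fun i hi => by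
    rw [adjMatrix_add_one_mulVec_apply, if_pos hi, sum_eq_zero, zero_add]
    exact fun j hj => if_neg fun hjS => hind i hi j hjS ((G.mem_neighborFinset i j).1 hj)
  refine ⟨hnonneg, fun i => ?_, sum_eq_zero fun i _ => ?_⟩
  · by_cases hi : i ∈ S
    · exact (hone i hi).ge
    obtain ⟨j, hjS, hij⟩ : ∃ j ∈ S, G.Adj i j := by
      by_contra! h
      exact hi (insert_eq_self.1 (hmax _ (hind.insert h) (subset_insert i S)).symm)
    rw [adjMatrix_add_one_mulVec_apply, if_neg hi, add_zero]
    have hle := single_le_sum (f := fun i => if i ∈ S then (1 : ℝ) else 0)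
      (fun k _ => hnonneg k) ((G.mem_neighborFinset i j).2 hij)
    simpa only [if_pos hjS] using hle
  · by_cases hi : i ∈ S
    · rw [hone i hi, sub_self, mul_zero]
    · exact mul_eq_zero_of_left (if_neg hi) _

/-- For any simple graph `G` on `n` vertices, the independence number `α(G)` equals the
maximum of `eᵀx` over all solutions of `LCP(A+I, -e)`, and this maximum is moreover
attained at an integer vector, i.e. it also equals the maximum of `eᵀx` over all
integer solutions. -/
theorem stmt_1 {n : ℕ} (G : SimpleGraph (Fin n)) [DecidableRel G.Adj] (α : ℕ)
    (hα : IsGreatest {k : ℕ | ∃ S : Finset (Fin n), IsIndepFinset G S ∧ S.card = k} α) :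
    IsGreatest {v : ℝ | ∃ x : Fin n → ℝ, SolLCP G x ∧ v = ∑ i, x i} (α : ℝ) ∧
    IsGreatest {v : ℝ | ∃ x : Fin n → ℝ, SolLCP G x ∧ (∀ i, ∃ m : ℤ, x i = (m : ℝ)) ∧
      v = ∑ i, x i} (α : ℝ) := by
  obtain ⟨⟨S, hS, hcard⟩, hub⟩ := hα
  have hmax : IsMaxIndepFinset G S :=
    ⟨hS, fun T hT hST => eq_of_subset_of_card_le hST (hcard ▸ hub ⟨T, hT, rfl⟩)⟩
  have hsum : (α : ℝ) = ∑ i, if i ∈ S then (1 : ℝ) else 0 := by simp [hcard]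
  have hbound : ∀ x : Fin n → ℝ, SolLCP G x → ∑ i, x i ≤ α := fun x hx => by
    obtain ⟨T, hT, hle⟩ := hx.exists_isIndepFinset_sum_le_card
    exact hle.trans (Nat.cast_le.2 (hub ⟨T, hT, rfl⟩))
  refine ⟨⟨⟨_, hmax.solLCP, hsum⟩, ?_⟩, ⟨⟨_, hmax.solLCP, fun i => ?_, hsum⟩, ?_⟩⟩
  · rintro _ ⟨x, hx, rfl⟩
    exact hbound x hx
  · exact ⟨if i ∈ S then 1 else 0, by push_cast; rfl⟩
  · rintro _ ⟨x, hx, -, rfl⟩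
    exact hbound x hx
end

section
/- If G is a forest (a simple graph with no cycles) on n vertices with adjacency matrix A, then the independent domination number of G equals the minimum ℓ₁ norm over solutions of LCP(G); that is, β(G) = min{ eᵀx : x ∈ SOL(G) }. -/
open Matrix Finset

/-- In a forest there is a depth function under which adjacent vertices have different depths
and every vertex has at most one neighbor of smaller depth. -/
theorem SimpleGraph.IsAcyclic.exists_depth {V : Type*} {G : SimpleGraph V} (hG : G.IsAcyclic) :
    ∃ d : V → ℕ, (∀ u v, G.Adj u v → d u ≠ d v) ∧
      ∀ v a b, G.Adj v a → G.Adj v b → d a < d v → d b < d v → a = b := by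
  let r : V → V := fun v => (G.connectedComponentMk v).nonempty_supp.some
  have hr : ∀ v, G.Reachable (r v) v := fun v =>
    SimpleGraph.ConnectedComponent.exact (G.connectedComponentMk v).nonempty_supp.some_mem
  have hadj : ∀ {u v}, G.Adj u v → r u = r v := fun {u v} h => by
    simp only [r, SimpleGraph.ConnectedComponent.sound h.reachable]
  refine ⟨fun v => G.dist (r v) v, fun u v h => ?_, fun v a b ha hb hda hdb => ?_⟩
  · dsimp only
    rw [← hadj h]
    exact hG.dist_ne_of_adj h (hr u)
  · obtain ⟨p, hp, hpl⟩ := (hr v).exists_path_of_dist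
    have key : ∀ c, G.Adj v c → G.dist (r c) c < G.dist (r v) v → c = p.penultimate := by
      intro c hc hd
      rw [← hadj hc] at hd
      obtain ⟨q, hq, hql⟩ := ((hr v).trans hc.reachable).exists_path_of_dist
      refine hG.eq_penultimate_of_adj_end hp hc ?_
      refine hG.mem_support_of_ne_mem_support_of_adj_of_isPath hp hq hc fun hv => ?_
      have := congrArg SimpleGraph.Walk.length (hG.path_concat hp hq hc hv)
      rw [SimpleGraph.Walk.length_concat] at this
      omega
    rw [key a ha hda, key b hb hdb]

theorem IsMaxIndepFinset.exists_adj {V : Type*} [DecidableEq V] {G : SimpleGraph V} {S : Finset V}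
    (hS : IsMaxIndepFinset G S) {v : V} (hv : v ∉ S) : ∃ u ∈ S, G.Adj v u := by
  by_contra! h
  refine hv ?_
  rw [hS.2 (insert v S) ?_ (Finset.subset_insert v S)]
  · exact Finset.mem_insert_self v S
  · intro i hi j hj
    rcases Finset.mem_insert.1 hi with rfl | hiS <;> rcases Finset.mem_insert.1 hj with rfl | hjS
    · exact G.irrefl
    · exact h j hjS
    · exact fun hij => h i hiS hij.symm
    · exact hS.1 i hiS j hjS

theorem IsIndepFinset.isMax_of_dominating {V : Type*} {G : SimpleGraph V} {S : Finset V}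
    (hS : IsIndepFinset G S) (h : ∀ v ∉ S, ∃ u ∈ S, G.Adj v u) : IsMaxIndepFinset G S := by
  refine ⟨hS, fun T hT hST => hST.antisymm fun v hv => ?_⟩
  by_contra hvS
  obtain ⟨u, hu, huv⟩ := h v hvS
  exact hT v hv u (hST hu) huv

section LCP

variable {V : Type*} [Fintype V] {G : SimpleGraph V} [DecidableRel G.Adj]

theorem sum_neighborFinset_eq_of_unique {x : V → ℝ} (hx : ∀ i, 0 ≤ x i) {v a : V}
    (ha : G.Adj v a) (h : ∀ b, G.Adj v b → 0 < x b → b = a) :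
    ∑ u ∈ G.neighborFinset v, x u = x a := by
  refine Finset.sum_eq_single_of_mem a (by simpa) fun b hb hba => ?_
  by_contra hne
  exact hba (h b (by simpa using hb) ((hx b).lt_of_ne' hne))

variable [DecidableEq V]

theorem adjMatrix_add_one_mulVec_apply_s2 (x : V → ℝ) (v : V) :
    ((G.adjMatrix ℝ + 1) *ᵥ x) v = ∑ u ∈ G.neighborFinset v, x u + x v := by
  rw [Matrix.add_mulVec, Matrix.one_mulVec, Pi.add_apply, SimpleGraph.adjMatrix_mulVec_apply]

theorem SolLCP.one_le {x : V → ℝ} (hx : SolLCP G x) (v : V) :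
    1 ≤ ∑ u ∈ G.neighborFinset v, x u + x v := by
  rw [← adjMatrix_add_one_mulVec_apply_s2]
  exact hx.2.1 v

theorem SolLCP.eq_one {x : V → ℝ} (hx : SolLCP G x) {v : V} (hv : 0 < x v) :
    ∑ u ∈ G.neighborFinset v, x u + x v = 1 := by
  have h := (Finset.sum_eq_zero_iff_of_nonneg fun i _ =>
    mul_nonneg (hx.1 i) (sub_nonneg.2 (hx.2.1 i))).1 hx.2.2 v (Finset.mem_univ v)
  rw [← adjMatrix_add_one_mulVec_apply_s2]
  linarith [(mul_eq_zero.1 h).resolve_left hv.ne']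

theorem add_le_sum_neighborFinset {x : V → ℝ} (hx : ∀ i, 0 ≤ x i) {v a b : V} (ha : G.Adj v a)
    (hb : G.Adj v b) (hab : a ≠ b) : x a + x b ≤ ∑ u ∈ G.neighborFinset v, x u := by
  rw [← Finset.sum_pair hab]
  refine Finset.sum_le_sum_of_subset_of_nonneg ?_ fun i _ _ => hx i
  intro i hi
  simp only [Finset.mem_insert, Finset.mem_singleton] at hi
  rcases hi with rfl | rfl <;> simpa

/-- The support of a solution on a forest induces a graph of maximum degree at most one. -/
theorem SolLCP.support_neighbor_unique {x : V → ℝ} (hx : SolLCP G x) {d : V → ℕ}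
    (hne : ∀ u v, G.Adj u v → d u ≠ d v)
    (huniq : ∀ v a b, G.Adj v a → G.Adj v b → d a < d v → d b < d v → a = b)
    {v a b : V} (hv : 0 < x v) (ha : G.Adj v a) (hb : G.Adj v b) (hxa : 0 < x a)
    (hxb : 0 < x b) : a = b := by
  have child : ∀ v p, 0 < x v → 0 < x p → G.Adj v p → d p < d v →
      ∀ c, G.Adj v c → 0 < x c → c = p := by
    intro v
    induction hm : Finset.univ.sup d - d v using Nat.strong_induction_on generalizing v with
    | _ m ih =>
      intro p hv hp hvp hd c hvc hc
      rcases lt_or_gt_of_ne (hne v c hvc) with hlt | hgt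
      · by_contra hcp
        have hle : d c ≤ Finset.univ.sup d := Finset.le_sup (Finset.mem_univ c)
        have h1 := sum_neighborFinset_eq_of_unique hx.1 hvc.symm
          (ih _ (by omega) c rfl v hc hv hvc.symm hlt)
        have h2 := hx.eq_one hc
        have h3 := hx.eq_one hv
        have h4 := add_le_sum_neighborFinset hx.1 hvc hvp hcp
        linarith
      · exact huniq v c p hvc hvp hgt hd
  rcases lt_or_gt_of_ne (hne v a ha) with hlt | hgt
  · by_contra hab
    have h1 := sum_neighborFinset_eq_of_unique hx.1 ha.symm (child a v hxa hv ha.symm hlt)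
    have h2 := hx.eq_one hxa
    have h3 := hx.eq_one hv
    have h4 := add_le_sum_neighborFinset hx.1 ha hb hab
    linarith
  · exact (child v a hv hxa ha hgt b hb hxb).symm

/-- The indicator vector of a maximal independent set solves the complementarity problem. -/
theorem IsMaxIndepFinset.solLCP_indicator {S : Finset V} (hS : IsMaxIndepFinset G S) :
    SolLCP G fun v => if v ∈ S then 1 else 0 := by
  have hnn : ∀ v : V, (0 : ℝ) ≤ if v ∈ S then 1 else 0 := fun v => by split_ifs <;> norm_num
  refine ⟨hnn, fun v => ?_, Finset.sum_eq_zero fun v _ => ?_⟩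
  · rw [adjMatrix_add_one_mulVec_apply_s2]
    by_cases hv : v ∈ S
    · rw [if_pos hv]
      linarith [Finset.sum_nonneg fun u (_ : u ∈ G.neighborFinset v) => hnn u]
    · obtain ⟨u, hu, huv⟩ := hS.exists_adj hv
      have := Finset.single_le_sum (fun u _ => hnn u) ((G.mem_neighborFinset v u).2 huv)
      rw [if_pos hu] at this
      linarith [hnn v]
  · by_cases hv : v ∈ S
    · rw [adjMatrix_add_one_mulVec_apply_s2, Finset.sum_eq_zero, if_pos hv]
      · norm_num
      · intro u hu
        exact if_neg fun huS => hS.1 v hv u huS ((G.mem_neighborFinset v u).1 hu)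
    · simp [hv]

/-- On a forest, every solution has total mass at least the size of some maximal independent
set, namely the support vertices without a support neighbor of smaller depth. -/
theorem SolLCP.exists_isMaxIndepFinset_card_le {x : V → ℝ} (hG : G.IsAcyclic)
    (hx : SolLCP G x) : ∃ S : Finset V, IsMaxIndepFinset G S ∧ (S.card : ℝ) ≤ ∑ i, x i := by
  obtain ⟨d, hne, huniq⟩ := hG.exists_depth
  have huq : ∀ {v a b}, 0 < x v → G.Adj v a → G.Adj v b → 0 < x a → 0 < x b → a = b :=
    hx.support_neighbor_unique hne huniq
  let S : Finset V := {v | 0 < x v ∧ ∀ u, G.Adj v u → 0 < x u → d v < d u}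
  have memS : ∀ v, v ∈ S ↔ 0 < x v ∧ ∀ u, G.Adj v u → 0 < x u → d v < d u := by simp [S]
  have hind : IsIndepFinset G S := fun i hi j hj hij =>
    lt_asymm (((memS i).1 hi).2 j hij ((memS j).1 hj).1)
      (((memS j).1 hj).2 i hij.symm ((memS i).1 hi).1)
  have parent : ∀ v, 0 < x v → v ∉ S → ∃ u, G.Adj v u ∧ 0 < x u ∧ d u < d v := by
    intro v hv hvS
    rw [memS] at hvS
    push Not at hvS
    obtain ⟨u, hvu, hu, hd⟩ := hvS hv
    exact ⟨u, hvu, hu, hd.lt_of_ne (hne v u hvu).symm⟩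
  refine ⟨S, hind.isMax_of_dominating fun v hvS => ?_, ?_⟩
  · rcases (hx.1 v).eq_or_lt with hv | hv
    · by_contra! hdom
      have up : ∀ y, G.Adj v y → 0 < x y → d y < d v ∧ x y < 1 := by
        intro y hvy hy
        obtain ⟨z, hyz, hz, hd⟩ := parent y hy fun hyS => hdom y hyS hvy
        have hzv : z ≠ v := by
          rintro rfl
          exact hz.ne hv
        refine ⟨(hne v y hvy).lt_or_gt.resolve_left fun hlt =>
          hzv (huniq y z v hyz hvy.symm hd hlt), ?_⟩
        have h1 := hx.eq_one hy
        have h2 := Finset.single_le_sum (fun u _ => hx.1 u) ((G.mem_neighborFinset y z).2 hyz)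
        linarith
      have h1 := hx.one_le v
      obtain ⟨y, hy, hxy⟩ := Finset.exists_lt_of_sum_lt
        (s := G.neighborFinset v) (f := fun _ => (0 : ℝ)) (g := x) (by simp; linarith)
      rw [G.mem_neighborFinset] at hy
      have hyv := up y hy hxy
      have h2 := sum_neighborFinset_eq_of_unique hx.1 hy fun b hb hxb =>
        huniq v b y hb hy (up b hb hxb).1 hyv.1
      linarith
    · obtain ⟨u, hvu, hu, hd⟩ := parent v hv hvS
      refine ⟨u, (memS u).2 ⟨hu, fun w huw hw => ?_⟩, hvu⟩
      rwa [huq hu huw hvu.symm hw hv]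
  · have hdisj : (S : Set V).PairwiseDisjoint
        fun v => insert v (G.neighborFinset v |>.filter (0 < x ·)) := by
      intro i hi j hj hij
      refine Finset.disjoint_left.2 fun w hwi hwj => ?_
      simp only [Finset.mem_insert, Finset.mem_filter, G.mem_neighborFinset] at hwi hwj
      rcases hwi with rfl | ⟨hiw, hw⟩ <;> rcases hwj with rfl | ⟨hjw, hw'⟩
      · exact hij rfl
      · exact hind j hj w hi hjw
      · exact hind i hi w hj hiw
      · exact hij (huq hw hiw.symm hjw.symm ((memS i).1 hi).1 ((memS j).1 hj).1)
    calc (S.card : ℝ) = ∑ v ∈ S, ∑ u ∈ insert v (G.neighborFinset v |>.filter (0 < x ·)), x u := by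
          rw [Finset.card_eq_sum_ones, Nat.cast_sum]
          refine Finset.sum_congr rfl fun v hv => ?_
          rw [Finset.sum_insert (by simp), Finset.sum_filter_of_ne
            fun u _ hu => (hx.1 u).lt_of_ne' hu, add_comm, hx.eq_one ((memS v).1 hv).1, Nat.cast_one]
      _ = ∑ u ∈ S.biUnion fun v => insert v (G.neighborFinset v |>.filter (0 < x ·)), x u :=
          (Finset.sum_biUnion hdisj).symm
      _ ≤ ∑ i, x i := Finset.sum_le_univ_sum_of_nonneg hx.1

end LCP

/-- For a forest `G`, the independent domination number `β(G)` (the minimum cardinality of a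
maximal independent set) equals the minimum of `eᵀx` over all solutions of `LCP(A+I, -e)`. -/
theorem stmt_2 {n : ℕ} (G : SimpleGraph (Fin n)) [DecidableRel G.Adj] (hG : G.IsAcyclic)
    (β : ℕ) (hβ : IsLeast {k : ℕ | ∃ S : Finset (Fin n), IsMaxIndepFinset G S ∧ S.card = k} β) :
    IsLeast {v : ℝ | ∃ x : Fin n → ℝ, SolLCP G x ∧ v = ∑ i, x i} (β : ℝ) := by
  obtain ⟨⟨S, hS, rfl⟩, hmin⟩ := hβ
  refine ⟨⟨_, hS.solLCP_indicator, by simp⟩, ?_⟩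
  rintro _ ⟨x, hx, rfl⟩
  obtain ⟨T, hT, hle⟩ := hx.exists_isMaxIndepFinset_card_le hG
  exact (Nat.cast_le.2 (hmin ⟨T, hT, rfl⟩)).trans hle
end
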